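/- arXiv:2308.15437 — 5 statements merged into one kernel-verified Lean document; each statement's English description precedes it below -/
import Mathlib

section
/- Let H be a complex Hilbert space, Π : H →L[ℂ] H a continuous linear operator, and S a set of continuous linear operators on H such that for all E, F ∈ S there exists c : ℂ with Π ∘ E† ∘ F ∘ Π = c • Π. Then for all E, F in the ℂ-linear span of S, there exists c : ℂ with Π ∘ E† ∘ F ∘ Π = c • Π. -/
theorem correctable_span
    {H : Type*} [NormedAddCommGroup H] [InnerProductSpace ℂ H] [CompleteSpace H]
    (Prj : H →L[ℂ] H) (S : Set (H →L[ℂ] H))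
    (h : ∀ E ∈ S, ∀ F ∈ S, ∃ c : ℂ,
      Prj ∘L ContinuousLinearMap.adjoint E ∘L F ∘L Prj = c • Prj) :
    ∀ E ∈ Submodule.span ℂ S, ∀ F ∈ Submodule.span ℂ S, ∃ c : ℂ,
      Prj ∘L ContinuousLinearMap.adjoint E ∘L F ∘L Prj = c • Prj := by
  intro E hE F hF
  induction hE, hF using Submodule.span_induction₂ with
  | mem_mem E F hE hF => exact h E hE F hF
  | zero_left F _ => exact ⟨0, by simp⟩
  | zero_right E _ => exact ⟨0, by simp⟩
  | add_left E₁ E₂ F _ _ _ h₁ h₂ =>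
    obtain ⟨a, ha⟩ := h₁
    obtain ⟨b, hb⟩ := h₂
    refine ⟨a + b, ?_⟩
    rw [map_add, ContinuousLinearMap.add_comp, ContinuousLinearMap.comp_add, ha, hb, add_smul]
  | add_right E F₁ F₂ _ _ _ h₁ h₂ =>
    obtain ⟨a, ha⟩ := h₁
    obtain ⟨b, hb⟩ := h₂
    refine ⟨a + b, ?_⟩
    rw [ContinuousLinearMap.add_comp, ContinuousLinearMap.comp_add,
      ContinuousLinearMap.comp_add, ha, hb, add_smul]
  | smul_left r E F _ _ h₁ =>
    obtain ⟨a, ha⟩ := h₁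
    refine ⟨starRingEnd ℂ r * a, ?_⟩
    rw [map_smulₛₗ, ContinuousLinearMap.smul_comp, ContinuousLinearMap.comp_smul, ha, mul_smul]
  | smul_right r E F _ _ h₁ =>
    obtain ⟨a, ha⟩ := h₁
    refine ⟨r * a, ?_⟩
    rw [ContinuousLinearMap.smul_comp, ContinuousLinearMap.comp_smul,
      ContinuousLinearMap.comp_smul, ha, mul_smul]
end

section
/- Let A be a 2×2 complex matrix. Then A is normal (A * Aᴴ = Aᴴ * A) if and only if there exist scalars a, b : ℂ and a matrix V ∈ Matrix.unitaryGroup (Fin 2) ℂ with Vᴴ = V and trace V = 0 such that A = a • 1 + b • V. -/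
open Matrix
open scoped ComplexConjugate

/-- Entries of a normal traceless matrix `!![d, q; r, -d]` that squares to the identity:
the matrix is Hermitian. -/
lemma conj_entries_of_normal_of_sq_eq_one {d q r : ℂ} (hqr : q * conj q = r * conj r)
    (hd : d * conj r = q * conj d) (hsq : d ^ 2 + q * r = 1) :
    conj d = d ∧ conj q = r ∧ conj r = q := by
  obtain ⟨t, ht, ht0⟩ : ∃ t : ℝ, d * conj d + r * conj r = t ∧ 0 ≤ t :=
    ⟨Complex.normSq d + Complex.normSq r, by simp [Complex.mul_conj],
      add_nonneg (Complex.normSq_nonneg _) (Complex.normSq_nonneg _)⟩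
  have e1 : conj d = t * d := by
    rw [← ht]; linear_combination (-conj d) * hsq - r * hd
  have e2 : conj r = t * q := by
    rw [← ht]; linear_combination (-conj r) * hsq + d * hd
  have e1' : d = t * conj d := by simpa using congrArg conj e1
  have e2' : r = t * conj q := by simpa using congrArg conj e2
  have hd2 : ((t : ℂ) ^ 2 - 1) * d = 0 := by linear_combination (-t : ℂ) * e1 - e1'
  have hq2 : ((t : ℂ) ^ 2 - 1) * (q * conj q) = 0 := by
    linear_combination (-1 : ℂ) * hqr - conj r * e2' - t * conj q * e2
  have hone : (t : ℂ) ^ 2 - 1 = 0 := by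
    by_contra hne
    have d0 : d = 0 := by simpa [hne] using hd2
    have q0 : q = 0 := by simpa [hne] using hq2
    simp [d0, q0] at hsq
  have t1 : t = 1 := by
    have h : t ^ 2 - 1 = 0 := by exact_mod_cast hone
    nlinarith
  subst t1
  simp only [Complex.ofReal_one, one_mul] at e1 e2 e2'
  exact ⟨e1, e2'.symm, e2⟩

/-- A normal traceless matrix `!![d, q; r, -d]` that squares to zero vanishes. -/
lemma entries_eq_zero_of_normal_of_sq_eq_zero {d q r : ℂ} (hqr : q * conj q = r * conj r)
    (hd : d * conj r = q * conj d) (hsq : d ^ 2 + q * r = 0) :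
    d = 0 ∧ q = 0 ∧ r = 0 := by
  have hzero : q = 0 ↔ r = 0 := by
    rw [← Complex.normSq_eq_zero (z := q), ← Complex.normSq_eq_zero (z := r)]
    rw [Complex.mul_conj, Complex.mul_conj] at hqr
    rw [Complex.ofReal_inj.mp hqr]
  have e : d * ((Complex.normSq d + Complex.normSq r : ℝ) : ℂ) = 0 := by
    push_cast
    rw [← Complex.mul_conj, ← Complex.mul_conj]
    linear_combination conj d * hsq + r * hd
  have d0 : d = 0 := by
    rcases mul_eq_zero.mp e with h | h
    · exact h
    · have h' : Complex.normSq d + Complex.normSq r = 0 := by exact_mod_cast h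
      exact Complex.normSq_eq_zero.mp
        (by linarith [Complex.normSq_nonneg d, Complex.normSq_nonneg r])
  subst d0
  have : q * r = 0 := by simpa using hsq
  rcases mul_eq_zero.mp this with h | h
  · exact ⟨rfl, h, hzero.mp h⟩
  · exact ⟨rfl, hzero.mpr h, h⟩

/-- The matrix `!![d, q; r, -d]` is a self-adjoint traceless unitary as soon as its entries
are Hermitian and it squares to the identity. -/
lemma traceless_mem_unitaryGroup {d q r : ℂ} (hd : conj d = d) (hq : conj q = r)
    (hr : conj r = q) (hsq : d ^ 2 + q * r = 1) :
    !![d, q; r, -d] ∈ Matrix.unitaryGroup (Fin 2) ℂ ∧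
      (!![d, q; r, -d])ᴴ = !![d, q; r, -d] ∧ (!![d, q; r, -d]).trace = 0 := by
  have hH : (!![d, q; r, -d])ᴴ = !![d, q; r, -d] := by
    ext i j
    fin_cases i <;> fin_cases j <;> simp [hd, hq, hr]
  refine ⟨?_, hH, by simp [Matrix.trace_fin_two]⟩
  rw [Matrix.mem_unitaryGroup_iff, Matrix.star_eq_conjTranspose, hH]
  ext i j
  fin_cases i <;> fin_cases j <;> simp [Matrix.mul_apply, Fin.sum_univ_two] <;>
    first | linear_combination hsq | ring

theorem normal_iff_id_add_paulian (A : Matrix (Fin 2) (Fin 2) ℂ) :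
    A * Aᴴ = Aᴴ * A ↔
      ∃ (a b : ℂ) (V : Matrix (Fin 2) (Fin 2) ℂ),
        V ∈ Matrix.unitaryGroup (Fin 2) ℂ ∧ Vᴴ = V ∧ V.trace = 0 ∧
        A = a • 1 + b • V := by
  constructor
  · intro h
    obtain ⟨a, d, q, r, rfl⟩ : ∃ a d q r : ℂ, A = !![a + d, q; r, a - d] := by
      refine ⟨(A 0 0 + A 1 1) / 2, (A 0 0 - A 1 1) / 2, A 0 1, A 1 0, ?_⟩
      ext i j
      fin_cases i <;> fin_cases j <;> simp <;> ring
    have h00 := congrFun (congrFun h 0) 0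
    have h01 := congrFun (congrFun h 0) 1
    simp [Matrix.mul_apply, Fin.sum_univ_two] at h00 h01
    have hqr : q * conj q = r * conj r := by linear_combination h00
    have hd : d * conj r = q * conj d := by linear_combination h01 / 2
    obtain ⟨b, hb⟩ := IsAlgClosed.exists_pow_nat_eq (d ^ 2 + q * r) two_pos
    by_cases hb0 : b = 0
    · obtain ⟨rfl, rfl, rfl⟩ := entries_eq_zero_of_normal_of_sq_eq_zero hqr hd
        (by simp [← hb, hb0])
      refine ⟨a, 0, !![1, 0; 0, -1], ?_⟩
      obtain ⟨hU, hH, hT⟩ := traceless_mem_unitaryGroup (d := 1) (q := 0) (r := 0)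
        (by simp) (by simp) (by simp) (by simp)
      refine ⟨hU, hH, hT, ?_⟩
      ext i j
      fin_cases i <;> fin_cases j <;> simp
    · have hcb : conj b ≠ 0 := by simpa using hb0
      have hsq : (d / b) ^ 2 + q / b * (r / b) = 1 := by
        field_simp
        linear_combination -hb
      obtain ⟨k1, k2, k3⟩ := conj_entries_of_normal_of_sq_eq_one (d := d / b) (q := q / b)
        (r := r / b)
        (by rw [map_div₀, map_div₀, div_mul_div_comm, div_mul_div_comm, hqr])
        (by rw [map_div₀, map_div₀, div_mul_div_comm, div_mul_div_comm, hd]) hsq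
      obtain ⟨hU, hH, hT⟩ := traceless_mem_unitaryGroup k1 k2 k3 hsq
      refine ⟨a, b, _, hU, hH, hT, ?_⟩
      ext i j
      fin_cases i <;> fin_cases j <;> simp <;> field_simp <;> ring
  · rintro ⟨a, b, V, -, hV, -, rfl⟩
    have hcomm : Commute (a • (1 : Matrix (Fin 2) (Fin 2) ℂ) + b • V) (conj a • 1 + conj b • V) :=
      (((Commute.one_left _).smul_left a).add_left
        ((((Commute.one_right V).smul_right _).add_right
          ((Commute.refl V).smul_right _)).smul_left b))
    simpa [hV] using hcomm.eq
end

section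
/- Let R be a ring and G a subgroup of the group of units Rˣ such that (i) every g ∈ G satisfies g² = 1 or g² = −1 (in Rˣ), and (ii) any two elements g, h ∈ G satisfy g * h = h * g or g * h = −(h * g). If −1 ∉ G, then every element of G satisfies g² = 1, and G is abelian: g * h = h * g for all g, h ∈ G. -/
theorem pauli_subgroup_involutive_abelian
    {R : Type*} [Ring R] (G : Subgroup Rˣ)
    (hsq : ∀ g ∈ G, g ^ 2 = 1 ∨ g ^ 2 = -1)
    (hcomm : ∀ g ∈ G, ∀ h ∈ G, g * h = h * g ∨ g * h = -(h * g))
    (hneg : (-1 : Rˣ) ∉ G) :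
    (∀ g ∈ G, g ^ 2 = 1) ∧ (∀ g ∈ G, ∀ h ∈ G, g * h = h * g) := by
  refine ⟨fun g hg => (hsq g hg).resolve_right fun h => hneg (h ▸ G.pow_mem hg 2), ?_⟩
  intro g hg h hh
  refine (hcomm g hg h hh).resolve_right fun e => hneg ?_
  have key : g * h * (h * g)⁻¹ = -1 := by rw [e, neg_mul, mul_inv_cancel]
  exact key ▸ G.mul_mem (G.mul_mem hg hh) (G.inv_mem (G.mul_mem hh hg))
end

section
/- Let H be a complex Hilbert space, m a positive natural number, and K : (Fin m → Bool) → Submodule ℂ H a family of 2^m closed subspaces that are pairwise orthogonal (for s ≠ t, ⟪v, w⟫ = 0 whenever v ∈ K s and w ∈ K t) and satisfy ⨆ t, K t = ⊤. Then there exist continuous linear operators Z : Fin m → (H →L[ℂ] H) such that: each Z i is self-adjoint and satisfies Z i ∘ Z i = id (hence each Z i is unitary); the Z i pairwise commute; and for every t : Fin m → Bool, K t = ⋂_{i} eigenspace(Z i, ε(t i)), where ε(true) = 1 and ε(false) = −1. -/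
open scoped InnerProductSpace

theorem ContinuousLinearMap.ext_of_iSup_eq_top {ι 𝕜 E : Type*} [RCLike 𝕜] [NormedAddCommGroup E]
    [InnerProductSpace 𝕜 E] {K : ι → Submodule 𝕜 E} (htop : ⨆ t, K t = ⊤)
    {A B : E →L[𝕜] E} (h : ∀ t, ∀ v ∈ K t, A v = B v) : A = B := by
  have hle : ⨆ t, K t ≤ LinearMap.eqLocus (A : E →ₗ[𝕜] E) (B : E →ₗ[𝕜] E) := iSup_le h
  ext v
  exact hle (htop ▸ Submodule.mem_top)

section WeightedProjections

variable {ι 𝕜 E : Type*} [Fintype ι] [RCLike 𝕜] [NormedAddCommGroup E] [InnerProductSpace 𝕜 E]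
  {K : ι → Submodule 𝕜 E} [∀ t, (K t).HasOrthogonalProjection]

/-- The linear combination, with coefficients `c`, of the orthogonal projections onto the members
of a finite family of subspaces. -/
noncomputable def weightedStarProjection (K : ι → Submodule 𝕜 E)
    [∀ t, (K t).HasOrthogonalProjection] (c : ι → 𝕜) : E →L[𝕜] E :=
  ∑ t, c t • (K t).starProjection

theorem weightedStarProjection_apply_of_mem (hK : Pairwise fun s t => K s ⟂ K t) (c : ι → 𝕜)
    {t : ι} {v : E} (hv : v ∈ K t) : weightedStarProjection K c v = c t • v := by
  classical
  rw [weightedStarProjection, sum_apply, Finset.sum_eq_single t]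
  · simp [Submodule.starProjection_eq_self_iff.2 hv]
  · intro s _ hst
    have h : (K s).starProjection v = 0 :=
      (K s).starProjection_apply_eq_zero_iff.2 ((hK hst).symm hv)
    simp [h]
  · simp

theorem weightedStarProjection_one (hK : Pairwise fun s t => K s ⟂ K t) (htop : ⨆ t, K t = ⊤) :
    weightedStarProjection K 1 = 1 :=
  ContinuousLinearMap.ext_of_iSup_eq_top htop fun _ _ hv => by
    simp [weightedStarProjection_apply_of_mem hK _ hv]

theorem weightedStarProjection_comp (hK : Pairwise fun s t => K s ⟂ K t) (htop : ⨆ t, K t = ⊤)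
    (c d : ι → 𝕜) :
    weightedStarProjection K c ∘L weightedStarProjection K d = weightedStarProjection K (c * d) :=
  ContinuousLinearMap.ext_of_iSup_eq_top htop fun _ _ hv => by
    simp [weightedStarProjection_apply_of_mem hK _ hv, smul_smul, mul_comm]

theorem starProjection_weightedStarProjection (hK : Pairwise fun s t => K s ⟂ K t) (c : ι → 𝕜)
    (s : ι) (v : E) :
    (K s).starProjection (weightedStarProjection K c v) = c s • (K s).starProjection v := by
  classical
  rw [weightedStarProjection, sum_apply, map_sum, Finset.sum_eq_single s]
  · simp [Submodule.starProjection_eq_self_iff.2 ((K s).starProjection_apply_mem v)]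
  · intro t _ hts
    have h : (K s).starProjection ((K t).starProjection v) = 0 :=
      (K s).starProjection_apply_eq_zero_iff.2 (hK hts ((K t).starProjection_apply_mem v))
    simp [h]
  · simp

theorem adjoint_weightedStarProjection [CompleteSpace E] (c : ι → 𝕜) :
    ContinuousLinearMap.adjoint (weightedStarProjection K c) =
      weightedStarProjection K (star c) := by
  simp only [weightedStarProjection, ← ContinuousLinearMap.star_eq_adjoint, star_sum, star_smul,
    (isSelfAdjoint_starProjection _).star_eq, Pi.star_apply]

/-- A vector is a simultaneous eigenvector of operators diagonal with respect to an orthogonal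
decomposition only if it lies in the corresponding summand, provided that the tuples of
eigenvalues separate the summands. -/
theorem iInf_eigenspace_weightedStarProjection {κ : Type*} (hK : Pairwise fun s t => K s ⟂ K t)
    (htop : ⨆ t, K t = ⊤) (c : κ → ι → 𝕜) (hc : ∀ s t, (∀ i, c i s = c i t) → s = t) (t : ι) :
    ⨅ i, Module.End.eigenspace (weightedStarProjection K (c i) : E →ₗ[𝕜] E) (c i t) = K t := by
  refine le_antisymm (fun v hv => ?_) (le_iInf fun i v hv => ?_)
  · simp only [Submodule.mem_iInf, Module.End.mem_eigenspace_iff,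
      ContinuousLinearMap.coe_coe] at hv
    have hzero : ∀ s, s ≠ t → (K s).starProjection v = 0 := by
      intro s hst
      by_contra hne
      refine hst (hc s t fun i => smul_left_injective 𝕜 hne ?_)
      simp only
      rw [← starProjection_weightedStarProjection hK, hv i, map_smul]
    have hsum : weightedStarProjection K 1 v = (K t).starProjection v := by
      rw [weightedStarProjection, sum_apply, Finset.sum_eq_single t]
      · simp
      · intro s _ hst
        simp [hzero s hst]
      · simp
    rw [weightedStarProjection_one hK htop] at hsum
    exact Submodule.starProjection_eq_self_iff.1 hsum.symm
  · exact Module.End.mem_eigenspace_iff.2 (weightedStarProjection_apply_of_mem hK _ hv)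

end WeightedProjections

theorem exists_paulian_stabilizers
    {H : Type*} [NormedAddCommGroup H] [InnerProductSpace ℂ H] [CompleteSpace H]
    (m : ℕ) (hm : 0 < m) (K : (Fin m → Bool) → Submodule ℂ H)
    (hclosed : ∀ t, IsClosed ((K t : Set H)))
    (horth : ∀ s t, s ≠ t → ∀ v ∈ K s, ∀ w ∈ K t, ⟪v, w⟫_ℂ = 0)
    (htop : (⨆ t, K t) = ⊤) :
    ∃ Z : Fin m → (H →L[ℂ] H),
      (∀ i, ContinuousLinearMap.adjoint (Z i) = Z i) ∧
      (∀ i, Z i ∘L Z i = 1) ∧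
      (∀ i j, Z i ∘L Z j = Z j ∘L Z i) ∧
      (∀ t, K t = ⨅ i, Module.End.eigenspace ((Z i : H →L[ℂ] H) : H →ₗ[ℂ] H)
        (if t i then (1 : ℂ) else -1)) := by
  have (t : Fin m → Bool) : CompleteSpace (K t) := (hclosed t).completeSpace_coe
  have hK : Pairwise fun s t => K s ⟂ K t := fun s t hst =>
    Submodule.isOrtho_iff_inner_eq.2 (horth s t hst)
  let ε (i : Fin m) (t : Fin m → Bool) : ℂ := if t i then 1 else -1
  refine ⟨fun i => weightedStarProjection K (ε i), fun i => ?_, fun i => ?_, fun i j => ?_,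
    fun t => (iInf_eigenspace_weightedStarProjection hK htop ε (fun s t h => ?_) t).symm⟩
  · rw [adjoint_weightedStarProjection]
    congr 1
    ext t
    cases h : t i <;> simp [ε, h]
  · rw [weightedStarProjection_comp hK htop, ← weightedStarProjection_one hK htop]
    congr 1
    ext t
    cases h : t i <;> simp [ε, h]
  · simp only [weightedStarProjection_comp hK htop, mul_comm]
  · funext i
    have hi := h i
    cases hs : s i <;> cases ht : t i <;>
      first | rfl | norm_num [ε, hs, ht] at hi
end

section
/- Let H be a complex Hilbert space, m a positive natural number, and K : (Fin m → Bool) → Submodule ℂ H a family of 2^m closed subspaces that are pairwise orthogonal, satisfy ⨆ t, K t = ⊤, and are mutually isometrically isomorphic (for all s, t there is a linear isometric equivalence K s ≃ₗᵢ[ℂ] K t). Then there exist continuous linear operators Z, X : Fin m → (H →L[ℂ] H) such that: each Z i and each X i is self-adjoint and satisfies Z i ∘ Z i = id and X i ∘ X i = id; the Z i pairwise commute; the X i pairwise commute; X i commutes with Z j whenever i ≠ j; X i anticommutes with Z i (X i ∘ Z i = −(Z i ∘ X i)) for every i; and for every t : Fin m → Bool, K t = ⋂_{i} eigenspace(Z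 i, ε(t i)), where ε(true) = 1 and ε(false) = −1. -/
open scoped InnerProductSpace

section Monomial

variable {ι E H : Type*}
  [NormedAddCommGroup E] [InnerProductSpace ℂ E]
  [NormedAddCommGroup H] [InnerProductSpace ℂ H]

/-- The images of the `J t` span `H`, so operators are determined on them. -/
theorem ext_of_iSup_range {J : ι → E →L[ℂ] H}
    (hspan : (⨆ t, LinearMap.range (J t : E →ₗ[ℂ] H)) = ⊤) {A B : H →L[ℂ] H}
    (h : ∀ t x, A (J t x) = B (J t x)) : A = B := by
  have hle : (⨆ t, LinearMap.range (J t : E →ₗ[ℂ] H)) ≤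
      LinearMap.eqLocus (A : H →ₗ[ℂ] H) (B : H →ₗ[ℂ] H) := by
    refine iSup_le fun t => ?_
    rintro _ ⟨x, rfl⟩
    exact h t x
  ext v
  exact hle (hspan ▸ Submodule.mem_top : v ∈ _)

variable [CompleteSpace E] [CompleteSpace H]

/-- The operator sending the `t`-th copy of `E` to the `σ t`-th copy, scaled by `f t`. -/
noncomputable def monomialOp [Fintype ι] (J : ι → E →L[ℂ] H) (f : ι → ℂ) (σ : ι → ι) : H →L[ℂ] H :=
  ∑ t, f t • (J (σ t) ∘L ContinuousLinearMap.adjoint (J t))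

variable [Fintype ι] [DecidableEq ι] {J : ι → E →L[ℂ] H}

theorem monomialOp_apply
    (hJ : ∀ s t x, ContinuousLinearMap.adjoint (J s) (J t x) = if s = t then x else 0)
    (f : ι → ℂ) (σ : ι → ι) (t : ι) (x : E) :
    monomialOp J f σ (J t x) = f t • J (σ t) x := by
  simp only [monomialOp, sum_apply, smul_apply,
    ContinuousLinearMap.comp_apply, hJ]
  rw [Finset.sum_eq_single t] <;> simp +contextual

theorem adjoint_monomialOp
    (hJ : ∀ s t x, ContinuousLinearMap.adjoint (J s) (J t x) = if s = t then x else 0)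
    (hspan : (⨆ t, LinearMap.range (J t : E →ₗ[ℂ] H)) = ⊤)
    (f : ι → ℂ) {σ : ι → ι} (hσ : Function.Involutive σ) :
    ContinuousLinearMap.adjoint (monomialOp J f σ) =
      monomialOp J (fun t => starRingEnd ℂ (f (σ t))) σ := by
  refine ext_of_iSup_range hspan fun t x => ?_
  rw [monomialOp_apply hJ]
  simp only [monomialOp, map_sum, map_smulₛₗ, ContinuousLinearMap.adjoint_comp,
    ContinuousLinearMap.adjoint_adjoint,
    sum_apply, smul_apply,
    ContinuousLinearMap.comp_apply, hJ]
  rw [Finset.sum_eq_single (σ t)]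
  · simp [hσ t]
  · intro s _ hs
    have : σ s ≠ t := fun h => hs (by rw [← h, hσ s])
    simp [this]
  · simp

theorem sum_apply_adjoint
    (hJ : ∀ s t x, ContinuousLinearMap.adjoint (J s) (J t x) = if s = t then x else 0)
    (hspan : (⨆ t, LinearMap.range (J t : E →ₗ[ℂ] H)) = ⊤) (v : H) :
    ∑ t, J t (ContinuousLinearMap.adjoint (J t) v) = v := by
  have h : monomialOp J 1 id = 1 :=
    ext_of_iSup_range hspan fun t x => by simp [monomialOp_apply hJ]
  simpa [monomialOp] using congrArg (fun A : H →L[ℂ] H => A v) h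

theorem adjoint_monomialOp_id_apply
    (hJ : ∀ s t x, ContinuousLinearMap.adjoint (J s) (J t x) = if s = t then x else 0)
    (f : ι → ℂ) (s : ι) (v : H) :
    ContinuousLinearMap.adjoint (J s) (monomialOp J f id v) =
      f s • ContinuousLinearMap.adjoint (J s) v := by
  simp only [monomialOp, sum_apply, smul_apply,
    ContinuousLinearMap.comp_apply, map_sum, map_smul, hJ, id]
  rw [Finset.sum_eq_single s]
  · simp
  · intro t _ ht
    simp [ht.symm]
  · simp

end Monomial

/-- The eigenvalue of a Pauli `Z` labelled by a bit. -/
def bitSign (b : Bool) : ℂ := if b then 1 else -1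

theorem bitSign_mul_self (b : Bool) : bitSign b * bitSign b = 1 := by cases b <;> simp [bitSign]

theorem bitSign_not (b : Bool) : bitSign (!b) = -bitSign b := by cases b <;> simp [bitSign]

theorem conj_bitSign (b : Bool) : starRingEnd ℂ (bitSign b) = bitSign b := by
  cases b <;> simp [bitSign]

theorem bitSign_injective : Function.Injective bitSign := by
  have h : (1 : ℂ) ≠ -1 := by norm_num
  intro a b
  cases a <;> cases b <;> simp [bitSign, h, h.symm]

/-- Negate the `i`-th bit. -/
def flipBit {κ : Type*} [DecidableEq κ] (i : κ) (t : κ → Bool) : κ → Bool :=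
  Function.update t i (!t i)

section FlipBit

variable {κ : Type*} [DecidableEq κ]

theorem flipBit_self (i : κ) (t : κ → Bool) : flipBit i t i = !t i := by simp [flipBit]

theorem flipBit_of_ne {i j : κ} (h : j ≠ i) (t : κ → Bool) : flipBit i t j = t j := by
  simp [flipBit, h]

theorem flipBit_involutive (i : κ) : Function.Involutive (flipBit i) := by
  intro t
  simp [flipBit]

theorem flipBit_comm (i j : κ) (t : κ → Bool) :
    flipBit i (flipBit j t) = flipBit j (flipBit i t) := by
  rcases eq_or_ne i j with rfl | h
  · rfl
  · simp only [flipBit, Function.update_of_ne h, Function.update_of_ne h.symm]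
    exact Function.update_comm h.symm _ _ _

end FlipBit

theorem exists_paulian_representation
    {H : Type*} [NormedAddCommGroup H] [InnerProductSpace ℂ H] [CompleteSpace H]
    (m : ℕ) (hm : 0 < m) (K : (Fin m → Bool) → Submodule ℂ H)
    (hclosed : ∀ t, IsClosed ((K t : Set H)))
    (horth : ∀ s t, s ≠ t → ∀ v ∈ K s, ∀ w ∈ K t, ⟪v, w⟫_ℂ = 0)
    (htop : (⨆ t, K t) = ⊤)
    (hiso : ∀ s t, Nonempty (K s ≃ₗᵢ[ℂ] K t)) :
    ∃ Z X : Fin m → (H →L[ℂ] H),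
      (∀ i, ContinuousLinearMap.adjoint (Z i) = Z i) ∧
      (∀ i, ContinuousLinearMap.adjoint (X i) = X i) ∧
      (∀ i, Z i ∘L Z i = 1) ∧
      (∀ i, X i ∘L X i = 1) ∧
      (∀ i j, Z i ∘L Z j = Z j ∘L Z i) ∧
      (∀ i j, X i ∘L X j = X j ∘L X i) ∧
      (∀ i j, i ≠ j → X i ∘L Z j = Z j ∘L X i) ∧
      (∀ i, X i ∘L Z i = -(Z i ∘L X i)) ∧
      (∀ t, K t = ⨅ i, Module.End.eigenspace ((Z i : H →L[ℂ] H) : H →ₗ[ℂ] H)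
        (if t i then (1 : ℂ) else -1)) := by
  classical
  let base : Fin m → Bool := fun _ => false
  have : CompleteSpace (K base) := (hclosed base).completeSpace_coe
  let u : ∀ t, K base ≃ₗᵢ[ℂ] K t := fun t => (hiso base t).some
  let J : (Fin m → Bool) → K base →L[ℂ] H := fun t =>
    (K t).subtypeL ∘L ((u t).toContinuousLinearEquiv : K base →L[ℂ] K t)
  have hJu : ∀ t x, J t x = u t x := fun _ _ => rfl
  have hrange : ∀ t, LinearMap.range (J t : K base →ₗ[ℂ] H) = K t := by
    intro t
    ext v
    constructor
    · rintro ⟨x, rfl⟩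
      exact (u t x).2
    · intro hv
      exact ⟨(u t).symm ⟨v, hv⟩, by simp [hJu]⟩
  have hspan : (⨆ t, LinearMap.range (J t : K base →ₗ[ℂ] H)) = ⊤ := by simp only [hrange, htop]
  have hJ : ∀ s t x, ContinuousLinearMap.adjoint (J s) (J t x) = if s = t then x else 0 := by
    intro s t x
    refine ext_inner_left ℂ fun y => ?_
    rw [ContinuousLinearMap.adjoint_inner_right]
    split_ifs with h
    · subst h
      rw [hJu, hJu, ← Submodule.coe_inner, LinearIsometryEquiv.inner_map_map]
    · rw [inner_zero_right]
      exact horth s t h _ (u s y).2 _ (u t x).2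
  have key := monomialOp_apply hJ
  refine ⟨fun i => monomialOp J (fun t => bitSign (t i)) id,
    fun i => monomialOp J (fun _ => 1) (flipBit i), fun i => ?_, fun i => ?_, fun i => ?_,
    fun i => ?_, fun i j => ?_, fun i j => ?_, fun i j hij => ?_, fun i => ?_, fun t => ?_⟩
  · rw [adjoint_monomialOp hJ hspan _ (fun _ => rfl)]
    simp only [id, conj_bitSign]
  · rw [adjoint_monomialOp hJ hspan _ (flipBit_involutive i)]
    simp only [map_one]
  · refine ext_of_iSup_range hspan fun t x => ?_
    simp [key, smul_smul, bitSign_mul_self]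
  · refine ext_of_iSup_range hspan fun t x => ?_
    simp [key, flipBit_involutive i t]
  · refine ext_of_iSup_range hspan fun t x => ?_
    simp [key, smul_smul, mul_comm]
  · refine ext_of_iSup_range hspan fun t x => ?_
    simp [key, flipBit_comm i j]
  · refine ext_of_iSup_range hspan fun t x => ?_
    simp [key, flipBit_of_ne hij.symm]
  · refine ext_of_iSup_range hspan fun t x => ?_
    simp [key, flipBit_self, bitSign_not]
  · ext v
    simp only [Submodule.mem_iInf, Module.End.mem_eigenspace_iff, ContinuousLinearMap.coe_coe]
    constructor
    · intro hv i
      rw [← hrange t] at hv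
      obtain ⟨x, rfl⟩ := hv
      exact key _ id t x
    · intro hv
      have hzero : ∀ s, s ≠ t → ContinuousLinearMap.adjoint (J s) v = 0 := by
        intro s hs
        obtain ⟨i, hi⟩ := Function.ne_iff.mp hs
        have h := adjoint_monomialOp_id_apply hJ (fun t => bitSign (t i)) s v
        rw [hv i, map_smul] at h
        change bitSign (t i) • _ = _ at h
        rw [← sub_eq_zero, ← sub_smul, smul_eq_zero, sub_eq_zero] at h
        exact h.resolve_left fun h => hi (bitSign_injective h).symm
      have hsum := sum_apply_adjoint hJ hspan v
      rw [Finset.sum_eq_single t (fun s _ hs => by rw [hzero s hs, map_zero]) (by simp)] at hsum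
      rw [← hsum]
      exact (u t _).2
end
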